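/- Let R be a commutative Noetherian ring, let φ : R → R be a flat ring homomorphism, let N be a finitely generated R-module, and let θ : N → φ^{*}N be an R-linear map with iterates θ^{(e)} : N → φ^{e*}N. Then: (a) the increasing chain of submodules ker θ^{(1)} ⊆ ker θ^{(2)} ⊆ ⋯ stabilizes, say with stable value K (which equals the kernel of the natural map N → colim_e φ^{e*}N); (b) θ(K) is contained in the submodule φ^{*}K of φ^{*}N (this makes sense since φ is flat, so φ^{*}K → φ^{*}N is injective), hence θ descends to a map θ̄ : N/K → φ^{*}(N/K); and (c) the induced map θ̄ is injective. -/

import Mathlib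

open CategoryTheory Limits

universe u

section

variable {R : Type u} [CommRing R]

/-- The `e`-fold pullback `φ^{e*}N = N ⊗_{R, φ^e} R` of a module `N` along a ring
endomorphism `φ : R → R`, realized by iterating the extension-of-scalars functor. -/
noncomputable def pullIter (φ : R →+* R) (N : ModuleCat.{u} R) : ℕ → ModuleCat.{u} R
  | 0 => N
  | e + 1 => (ModuleCat.extendScalars φ).obj (pullIter φ N e)

/-- The transition maps `φ^{e*}θ : φ^{e*}N ⟶ φ^{(e+1)*}N` of the direct system induced
by `θ : N ⟶ φ^{*}N`. -/
noncomputable def pullSys (φ : R →+* R) {N : ModuleCat.{u} R}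
    (θ : N ⟶ (ModuleCat.extendScalars φ).obj N) :
    ∀ e : ℕ, pullIter φ N e ⟶ pullIter φ N (e + 1)
  | 0 => θ
  | e + 1 => (ModuleCat.extendScalars φ).map (pullSys φ θ e)

/-- The iterate `θ^{(e)} : N ⟶ φ^{e*}N`, the composite of the first `e` transition maps. -/
noncomputable def pullIterMap (φ : R →+* R) {N : ModuleCat.{u} R}
    (θ : N ⟶ (ModuleCat.extendScalars φ).obj N) : ∀ e : ℕ, N ⟶ pullIter φ N e
  | 0 => 𝟙 N
  | e + 1 => pullIterMap φ θ e ≫ pullSys φ θ e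

end

section

variable {R : Type u} [CommRing R] (φ : R →+* R)

theorem pullIterMap_succ_eq_comp_map {N : ModuleCat.{u} R}
    (θ : N ⟶ (ModuleCat.extendScalars φ).obj N) (e : ℕ) :
    pullIterMap φ θ (e + 1) =
      θ ≫ (ModuleCat.extendScalars φ).map (pullIterMap φ θ e) := by
  induction e with
  | zero =>
    change 𝟙 N ≫ θ = θ ≫ (ModuleCat.extendScalars φ).map (𝟙 N)
    rw [Category.id_comp, CategoryTheory.Functor.map_id, Category.comp_id]
  | succ e ih =>
    change pullIterMap φ θ (e + 1) ≫ (ModuleCat.extendScalars φ).map (pullSys φ θ e) =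
      θ ≫ (ModuleCat.extendScalars φ).map (pullIterMap φ θ e ≫ pullSys φ θ e)
    rw [ih, Functor.map_comp]
    exact Category.assoc _ _ _

theorem ofSequence_pullSys_map_zero {N : ModuleCat.{u} R}
    (θ : N ⟶ (ModuleCat.extendScalars φ).obj N) (e : ℕ) :
    (Functor.ofSequence (pullSys φ θ)).map (homOfLE e.zero_le) = pullIterMap φ θ e := by
  induction e with
  | zero => exact (Functor.ofSequence (pullSys φ θ)).map_id 0
  | succ e ih =>
    rw [← homOfLE_comp e.zero_le (Nat.le_add_right e 1), Functor.map_comp, ih,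
      Functor.ofSequence_map_homOfLE_succ]
    rfl

theorem monotone_ker_pullIterMap {N : ModuleCat.{u} R}
    (θ : N ⟶ (ModuleCat.extendScalars φ).obj N) :
    Monotone fun e => LinearMap.ker (pullIterMap φ θ e).hom := by
  refine monotone_nat_of_le_succ fun e => ?_
  change _ ≤ LinearMap.ker ((pullSys φ θ e).hom ∘ₗ (pullIterMap φ θ e).hom)
  exact LinearMap.ker_le_ker_comp _ _

theorem mem_ker_colimit_ι_zero_iff {N : ModuleCat.{u} R}
    (θ : N ⟶ (ModuleCat.extendScalars φ).obj N) (x : N) :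
    x ∈ LinearMap.ker (colimit.ι (Functor.ofSequence (pullSys φ θ)) 0).hom ↔
      ∃ e, x ∈ LinearMap.ker (pullIterMap φ θ e).hom := by
  constructor
  · intro hx
    have : PreservesFilteredColimitsOfSize.{0, 0} (forget (ModuleCat.{u} R)) :=
      preservesFilteredColimitsOfSize_shrink.{0, u, 0, u} _
    obtain ⟨e, i, hi⟩ := Concrete.colimit_rep_eq_zero.{u} R
      (Functor.ofSequence (pullSys φ θ)) 0 x hx
    obtain rfl := Subsingleton.elim i (homOfLE e.zero_le)
    rw [ofSequence_pullSys_map_zero] at hi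
    exact ⟨e, hi⟩
  · rintro ⟨e, he⟩
    have h := colimit.w (Functor.ofSequence (pullSys φ θ)) (homOfLE e.zero_le)
    rw [ofSequence_pullSys_map_zero] at h
    have hx := (congrArg (colimit.ι (Functor.ofSequence (pullSys φ θ)) e) he).trans (map_zero _)
    exact (ConcreteCategory.congr_hom h x).symm.trans hx

/-- A morphism of modules killing a submodule factors through the quotient. -/
theorem exists_mkQ_comp_eq {N : Type u} [AddCommGroup N] [Module R N] (K : Submodule R N)
    {X : ModuleCat.{u} R} (f : ModuleCat.of R N ⟶ X) (hf : K ≤ LinearMap.ker f.hom) :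
    ∃ g : ModuleCat.of R (N ⧸ K) ⟶ X, ModuleCat.ofHom K.mkQ ≫ g = f :=
  ⟨ModuleCat.ofHom (K.liftQ f.hom hf), rfl⟩

variable {φ}

/-- Flat extension of scalars commutes with the formation of kernels. -/
theorem mem_range_extendScalars_map_ker_subtype (hφ : φ.Flat) {M N : ModuleCat.{u} R}
    (g : M ⟶ N) {y : (ModuleCat.extendScalars φ).obj M}
    (hy : (ModuleCat.extendScalars φ).map g y = 0) :
    y ∈ LinearMap.range ((ModuleCat.extendScalars φ).map
      (ModuleCat.ofHom (LinearMap.ker g.hom).subtype)).hom := by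
  have := ModuleCat.preservesFiniteLimits_extendScalars_of_flat hφ
  let S : ShortComplex (ModuleCat.{u} R) :=
    ShortComplex.mk (ModuleCat.ofHom (LinearMap.ker g.hom).subtype) g
      (by ext x; exact x.2)
  have hS : S.Exact := (ShortComplex.moduleCat_exact_iff S).2 fun x hx => ⟨⟨x, hx⟩, rfl⟩
  exact (ShortComplex.moduleCat_exact_iff _).1 (hS.map (ModuleCat.extendScalars φ)) y hy

end

/-- Let `R` be a commutative Noetherian ring, `φ : R → R` a flat ring
homomorphism, `N` a finitely generated `R`-module and `θ : N ⟶ φ^{*}N` with iterates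
`θ^{(e)} : N ⟶ φ^{e*}N`. Then: (a) the chain `ker θ^{(1)} ⊆ ker θ^{(2)} ⊆ ⋯`
stabilizes, with stable value `K` equal to the kernel of the natural map
`N ⟶ colim_e φ^{e*}N`; (b) `θ(K)` lands in the image of `φ^{*}K → φ^{*}N`, so `θ`
descends to `θ̄ : N/K ⟶ φ^{*}(N/K)`; and (c) `θ̄` is injective. -/
theorem exists_stable_kernel_and_injective_descent
    {R : Type u} [CommRing R] [IsNoetherianRing R]
    (φ : R →+* R) (hφ : φ.Flat)
    (N : Type u) [AddCommGroup N] [Module R N] [Module.Finite R N]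
    (θ : ModuleCat.of R N ⟶ (ModuleCat.extendScalars φ).obj (ModuleCat.of R N)) :
    ∃ e₀ : ℕ, 1 ≤ e₀ ∧
      (∀ e : ℕ, e₀ ≤ e →
        LinearMap.ker (pullIterMap φ θ e).hom = LinearMap.ker (pullIterMap φ θ e₀).hom) ∧
      LinearMap.ker (pullIterMap φ θ e₀).hom =
        LinearMap.ker (colimit.ι (Functor.ofSequence (pullSys φ θ)) 0).hom ∧
      (∀ x : N, x ∈ LinearMap.ker (pullIterMap φ θ e₀).hom →
        θ x ∈ LinearMap.range ((ModuleCat.extendScalars φ).map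
          (ModuleCat.ofHom (LinearMap.ker (pullIterMap φ θ e₀).hom).subtype)).hom) ∧
      ∃ θbar : ModuleCat.of R (N ⧸ LinearMap.ker (pullIterMap φ θ e₀).hom) ⟶
          (ModuleCat.extendScalars φ).obj
            (ModuleCat.of R (N ⧸ LinearMap.ker (pullIterMap φ θ e₀).hom)),
        ModuleCat.ofHom (LinearMap.ker (pullIterMap φ θ e₀).hom).mkQ ≫ θbar =
          θ ≫ (ModuleCat.extendScalars φ).map
            (ModuleCat.ofHom (LinearMap.ker (pullIterMap φ θ e₀).hom).mkQ) ∧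
        Function.Injective θbar := by
  obtain ⟨n, hn⟩ := monotone_stabilizes_iff_noetherian.mpr
    (inferInstance : IsNoetherian R N) ⟨_, monotone_ker_pullIterMap φ θ⟩
  have stable : ∀ e, n + 1 ≤ e → LinearMap.ker (pullIterMap φ θ e).hom =
      LinearMap.ker (pullIterMap φ θ (n + 1)).hom := fun e he =>
    (hn e (by omega)).symm.trans (hn (n + 1) (by omega))
  refine ⟨n + 1, by omega, stable, ?_, ?_⟩
  · ext x
    refine Iff.trans ⟨fun hx => ⟨_, hx⟩, fun ⟨e, he⟩ => ?_⟩
      (mem_ker_colimit_ι_zero_iff φ θ x).symm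
    rw [← stable _ (le_max_right e (n + 1))]
    exact monotone_ker_pullIterMap φ θ (le_max_left _ _) he
  have hker : ∀ x : N, x ∈ LinearMap.ker (pullIterMap φ θ (n + 1)).hom ↔
      (ModuleCat.extendScalars φ).map (pullIterMap φ θ (n + 1)) (θ x) = 0 := fun x => by
    rw [← stable (n + 1 + 1) (by omega), pullIterMap_succ_eq_comp_map φ θ (n + 1)]
    rfl
  have hrange := fun (x : N) hx =>
    mem_range_extendScalars_map_ker_subtype hφ (pullIterMap φ θ (n + 1)) ((hker x).1 hx)
  refine ⟨hrange, ?_⟩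
  generalize pullIterMap φ θ (n + 1) = g at *
  let q := ModuleCat.ofHom (LinearMap.ker g.hom).mkQ
  let ι := ModuleCat.ofHom (LinearMap.ker g.hom).subtype
  have hιq : ι ≫ q = 0 := by
    ext x
    exact (Submodule.Quotient.mk_eq_zero _).2 x.2
  have hq : ∀ y, (ModuleCat.extendScalars φ).map q y = 0 →
      (ModuleCat.extendScalars φ).map g y = 0 := fun y hy => by
    have hfac : g = q ≫ ModuleCat.ofHom ((LinearMap.ker g.hom).liftQ g.hom le_rfl) := rfl
    rw [hfac, Functor.map_comp]
    change (ModuleCat.extendScalars φ).map _ ((ModuleCat.extendScalars φ).map q y) = 0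
    rw [hy, map_zero]
  have hle : LinearMap.ker g.hom ≤
      LinearMap.ker (θ ≫ (ModuleCat.extendScalars φ).map q).hom := fun x hx => by
    obtain ⟨z, hz⟩ := hrange x hx
    change (ModuleCat.extendScalars φ).map q (θ x) = 0
    rw [← hz]
    change ((ModuleCat.extendScalars φ).map ι ≫ (ModuleCat.extendScalars φ).map q) z = 0
    rw [← Functor.map_comp, hιq, Functor.map_zero]
    rfl
  obtain ⟨θbar, hθbar⟩ := exists_mkQ_comp_eq _ (θ ≫ (ModuleCat.extendScalars φ).map q) hle
  refine ⟨θbar, hθbar, (injective_iff_map_eq_zero θbar.hom).2 fun a ha => ?_⟩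
  obtain ⟨x, rfl⟩ := Submodule.Quotient.mk_surjective _ a
  exact (Submodule.Quotient.mk_eq_zero _).2
    ((hker x).2 (hq _ ((ConcreteCategory.congr_hom hθbar x).symm.trans ha)))
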